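/- arXiv:1403.6361 — 2 statements merged into one kernel-verified Lean document; each statement's English description precedes it below -/
import Mathlib

section
/- Let M = (M_i)_{i∈I} be a POVM on a finite-dimensional complex Hilbert space E with d := |I| ≥ 2 outcomes. Then for every n ≥ 1, every 0 < ε < 1, every 0 < δ < 1, and every density matrix ψ on the n-fold tensor power E^{⊗n}, the output distribution M^{⊗n}(ψ) on I^n, given by i^n ↦ tr(ψ·(M_{i₁} ⊗ ⋯ ⊗ M_{iₙ})), satisfies H_min^ε(M^{⊗n}(ψ)) ≥ n(Ĥ(M) − δ) − 16(log d)²·(1/δ)·log(1/ε). -/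
open scoped BigOperators ComplexOrder

noncomputable section

/-- A probability distribution on a finite type. -/
def IsProbDist {I : Type*} [Fintype I] (p : I → ℝ) : Prop :=
  (∀ i, 0 ≤ p i) ∧ ∑ i, p i = 1

/-- Shannon entropy (base 2), with the convention 0·log 0 = 0 (automatic since
`Real.logb 2 0 = 0`). -/
def shannonEntropy {I : Type*} [Fintype I] (p : I → ℝ) : ℝ :=
  - ∑ i, p i * Real.logb 2 (p i)

/-- A density matrix: positive semidefinite with trace 1. -/
def IsDensityMatrix {n : Type*} [Fintype n] (ρ : Matrix n n ℂ) : Prop :=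
  ρ.PosSemidef ∧ ρ.trace = 1

/-- A POVM: positive semidefinite elements summing to the identity. -/
def IsPOVM {n J : Type*} [Fintype n] [DecidableEq n] [Fintype J]
    (Q : J → Matrix n n ℂ) : Prop :=
  (∀ j, (Q j).PosSemidef) ∧ ∑ j, Q j = 1

/-- The `n`-fold tensor power of a family of matrices: for a word `iv : Fin n → I`,
the Kronecker product `M (iv 0) ⊗ ⋯ ⊗ M (iv (n-1))`, realized on the index set
`Fin n → Fin D`. -/
def tensorPowFam {D : ℕ} {I : Type*} (M : I → Matrix (Fin D) (Fin D) ℂ) (n : ℕ) :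
    (Fin n → I) → Matrix (Fin n → Fin D) (Fin n → Fin D) ℂ :=
  fun iv => Matrix.of fun x y => ∏ k, M (iv k) (x k) (y k)

/-- Min-entropy (base 2) of a probability distribution: `−log max_x q x`. -/
def distHmin {I : Type*} [Fintype I] (q : I → ℝ) : ℝ :=
  - Real.logb 2 (⨆ i, q i)

/-- Smooth min-entropy (base 2) of a probability distribution, smoothing in total
variation distance. -/
def smoothHminDist {I : Type*} [Fintype I] (ε : ℝ) (q : I → ℝ) : ℝ :=
  sSup { h : ℝ | ∃ q' : I → ℝ, IsProbDist q' ∧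
    (1/2) * ∑ i, |q i - q' i| ≤ ε ∧ h = distHmin q' }

/-- Minimum output entropy `Ĥ(M)` of the qc-channel associated with a POVM `M`. -/
def minOutEntropy {n I : Type*} [Fintype n] [Fintype I] (M : I → Matrix n n ℂ) : ℝ :=
  sInf { h : ℝ | ∃ ψ : Matrix n n ℂ, IsDensityMatrix ψ ∧
    h = shannonEntropy (fun i => ((ψ * M i).trace).re) }

theorem sum_cons_eq {n : ℕ} {α R : Type*} [Fintype α] [AddCommMonoid R] (f : (Fin (n+1) → α) → R) :
    ∑ z, f z = ∑ a, ∑ x : Fin n → α, f (Fin.cons a x) := by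
  rw [← (Fin.consEquiv (fun _ : Fin (n+1) => α)).sum_comp, Fintype.sum_prod_type]
  rfl

def redState {D n : ℕ} (ψ : Matrix (Fin (n+1) → Fin D) (Fin (n+1) → Fin D) ℂ)
    (A : Matrix (Fin D) (Fin D) ℂ) : Matrix (Fin n → Fin D) (Fin n → Fin D) ℂ :=
  Matrix.of fun x y => ∑ a, ∑ b, ψ (Fin.cons a x) (Fin.cons b y) * A b a

def margState {D n : ℕ} (ψ : Matrix (Fin (n+1) → Fin D) (Fin (n+1) → Fin D) ℂ) :
    Matrix (Fin D) (Fin D) ℂ :=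
  ∑ x : Fin n → Fin D, ψ.submatrix (fun a => (Fin.cons a x : Fin (n+1) → Fin D))
    (fun a => (Fin.cons a x : Fin (n+1) → Fin D))

theorem sumAll_psd {D n : ℕ} (H : Matrix (Fin (n+1) → Fin D) (Fin (n+1) → Fin D) ℂ)
    (hH : H.PosSemidef) :
    (Matrix.of fun (x y : Fin n → Fin D) =>
      ∑ a, ∑ b, H (Fin.cons a x) (Fin.cons b y)).PosSemidef := by
  classical
  have := hH.mul_mul_conjTranspose_same
    (Matrix.of fun (x : Fin n → Fin D) (z : Fin (n+1) → Fin D) => if Fin.tail z = x then (1:ℂ) else 0)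
  convert this using 1
  ext x y
  simp only [Matrix.mul_apply, Matrix.of_apply, Matrix.conjTranspose_apply, sum_cons_eq (n := n),
    Fin.tail_cons, apply_ite star, star_one, star_zero, mul_ite, ite_mul, mul_one, mul_zero, one_mul, zero_mul,
    Finset.sum_ite_eq', Finset.mem_univ, if_true]
  rw [Finset.sum_comm]

theorem redState_psd {D n : ℕ} {ψ : Matrix (Fin (n+1) → Fin D) (Fin (n+1) → Fin D) ℂ}
    {A : Matrix (Fin D) (Fin D) ℂ} (hψ : ψ.PosSemidef) (hA : A.PosSemidef) :
    (redState ψ A).PosSemidef := by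
  have h := sumAll_psd _ (hψ.hadamard (hA.transpose.submatrix (fun z : Fin (n+1) → Fin D => z 0)))
  simpa [redState, Matrix.hadamard] using h

theorem margState_psd {D n : ℕ} {ψ : Matrix (Fin (n+1) → Fin D) (Fin (n+1) → Fin D) ℂ}
    (hψ : ψ.PosSemidef) : (margState ψ).PosSemidef :=
  Matrix.posSemidef_sum _ fun x _ => hψ.submatrix _

theorem trace_margState {D n : ℕ} (ψ : Matrix (Fin (n+1) → Fin D) (Fin (n+1) → Fin D) ℂ) :
    (margState ψ).trace = ψ.trace := by
  simp only [margState, Matrix.trace_sum]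
  simp only [Matrix.trace, Matrix.diag_apply, Matrix.submatrix_apply, sum_cons_eq (n := n)]
  rw [Finset.sum_comm]

theorem trace_redState {D n : ℕ} (ψ : Matrix (Fin (n+1) → Fin D) (Fin (n+1) → Fin D) ℂ)
    (A : Matrix (Fin D) (Fin D) ℂ) :
    (redState ψ A).trace = (margState ψ * A).trace := by
  simp only [margState, Finset.sum_mul, Matrix.trace_sum, redState]
  simp [Matrix.trace, Matrix.mul_apply]

theorem trace_tensor_cons {D n : ℕ} {I : Type*} (M : I → Matrix (Fin D) (Fin D) ℂ)
    (ψ : Matrix (Fin (n+1) → Fin D) (Fin (n+1) → Fin D) ℂ) (i : I) (iv : Fin n → I) :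
    (ψ * tensorPowFam M (n+1) (Fin.cons i iv)).trace
      = (redState ψ (M i) * tensorPowFam M n iv).trace := by
  simp only [Matrix.trace, Matrix.diag_apply, Matrix.mul_apply, sum_cons_eq (n := n),
    redState, tensorPowFam, Matrix.of_apply, Fin.prod_univ_succ, Fin.cons_zero, Fin.cons_succ,
    Finset.sum_mul]
  rw [Finset.sum_comm]
  refine Finset.sum_congr rfl fun x _ => ?_
  conv_rhs => rw [Finset.sum_comm]
  refine Finset.sum_congr rfl fun a _ => ?_
  rw [Finset.sum_comm]
  refine Finset.sum_congr rfl fun y _ => Finset.sum_congr rfl fun b _ => ?_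
  ring

theorem trace_mul_psd_nonneg {D : ℕ} {A B : Matrix (Fin D) (Fin D) ℂ}
    (hA : A.PosSemidef) (hB : B.PosSemidef) : 0 ≤ (A * B).trace.re := by
  have h := (hA.hadamard hB.transpose).dotProduct_mulVec_nonneg (fun _ => 1)
  have h2 : (A * B).trace = star (fun _ => (1:ℂ)) ⬝ᵥ (A.hadamard B.transpose).mulVec (fun _ => 1) := by
    simp [Matrix.trace, Matrix.mul_apply, dotProduct, Matrix.mulVec]
  rw [h2]
  exact (Complex.le_def.1 h).1

theorem exp_neg_le_quad {x : ℝ} (hx : 0 ≤ x) : Real.exp (-x) ≤ 1 - x + x ^ 2 / 2 := by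
  have h := Real.quadratic_le_exp_of_nonneg hx
  have hpos : 0 < 1 - x + x ^ 2 / 2 := by nlinarith [sq_nonneg (x - 1)]
  rw [Real.exp_neg]
  rw [inv_le_iff_one_le_mul₀ (Real.exp_pos x)]
  calc (1:ℝ) ≤ (1 - x + x ^ 2 / 2) * (1 + x + x ^ 2 / 2) := by nlinarith [sq_nonneg (x ^ 2)]
    _ ≤ _ := mul_le_mul_of_nonneg_left h hpos.le

theorem term_log_sq {d : ℝ} (hd : 2 ≤ d) {p : ℝ} (h0 : 0 ≤ p) (h1 : p ≤ 1) :
    p * (Real.log p) ^ 2 ≤ 4 * p * (Real.log d) ^ 2 + 16 / d := by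
  have hdpos : 0 < d := by linarith
  rcases h0.eq_or_lt with rfl | hp
  · simp; positivity
  have hL : 0 < Real.log d := Real.log_pos (by linarith)
  by_cases hc : 1 / d ^ 2 ≤ p
  · have hlog : -(2 * Real.log d) ≤ Real.log p := by
      have := Real.log_le_log (by positivity) hc
      rw [Real.log_div one_ne_zero (by positivity), Real.log_pow, Real.log_one] at this
      push_cast at this; linarith
    have hlog0 : Real.log p ≤ 0 := Real.log_nonpos h0 h1
    have hsq : (Real.log p) ^ 2 ≤ 4 * (Real.log d) ^ 2 := by nlinarith
    have : 0 ≤ 16 / d := by positivity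
    nlinarith
  · push Not at hc
    have hr := Real.abs_log_mul_self_rpow_lt p (1/4) hp h1 (by norm_num)
    have hsq : (Real.log p * p ^ (1/4 : ℝ)) ^ 2 ≤ 16 := by
      have := sq_abs (Real.log p * p ^ (1/4 : ℝ))
      have h4 := abs_nonneg (Real.log p * p ^ (1/4 : ℝ))
      norm_num at hr
      norm_num at this h4 ⊢
      nlinarith
    have hs : p ^ (1/2 : ℝ) ≤ 1 / d := by
      rw [← Real.sqrt_eq_rpow]
      apply Real.sqrt_le_iff.2 ⟨by positivity, ?_⟩
      rw [div_pow, one_pow]; exact hc.le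
    have hpe : p = p ^ (1/2 : ℝ) * (p ^ (1/4 : ℝ)) ^ 2 := by
      rw [← Real.rpow_natCast (p ^ (1/4 : ℝ)), ← Real.rpow_mul h0, ← Real.rpow_add hp]
      norm_num
    have e1 : p * (Real.log p) ^ 2 = p ^ (1/2 : ℝ) * (Real.log p * p ^ (1/4 : ℝ)) ^ 2 := by
      rw [mul_pow, mul_comm ((Real.log p)^2), ← mul_assoc, ← hpe]
    have : p * (Real.log p) ^ 2 ≤ 1 / d * 16 := by
      rw [e1]; gcongr
    have h5 : 0 ≤ 4 * p * (Real.log d) ^ 2 := by positivity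
    have h6 : 1 / d * 16 = 16 / d := by ring
    linarith

theorem term_rpow {p s : ℝ} (h0 : 0 ≤ p) (h1 : p ≤ 1) (hs : 0 < s) :
    p ^ (1 + s) ≤ p + s * (p * Real.log p) + s ^ 2 / 2 * (p * (Real.log p) ^ 2) := by
  rcases h0.eq_or_lt with rfl | hp
  · rw [Real.zero_rpow (by linarith)]; simp
  have hl : Real.log p ≤ 0 := Real.log_nonpos h0 h1
  have h := exp_neg_le_quad (x := -(s * Real.log p)) (by nlinarith)
  rw [Real.rpow_add hp, Real.rpow_one, Real.rpow_def_of_pos hp, mul_comm (Real.log p)]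
  rw [neg_neg] at h
  nlinarith [mul_le_mul_of_nonneg_left h h0]

theorem le_one_of_dist {I : Type*} [Fintype I] {p : I → ℝ} (hp : IsProbDist p) (i : I) : p i ≤ 1 := by
  rw [← hp.2]; exact Finset.single_le_sum (fun j _ => hp.1 j) (Finset.mem_univ i)

theorem entropy_ln {I : Type*} [Fintype I] (p : I → ℝ) :
    Real.log 2 * shannonEntropy p = - ∑ i, p i * Real.log (p i) := by
  have : Real.log 2 ≠ 0 := (Real.log_pos one_lt_two).ne'
  simp only [shannonEntropy, Real.logb, mul_neg, Finset.mul_sum]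
  congr 1
  refine Finset.sum_congr rfl fun i _ => ?_
  field_simp

theorem entropy_nonneg {I : Type*} [Fintype I] {p : I → ℝ} (hp : IsProbDist p) :
    0 ≤ shannonEntropy p := by
  rw [shannonEntropy, neg_nonneg]
  refine Finset.sum_nonpos fun i _ => mul_nonpos_of_nonneg_of_nonpos (hp.1 i) ?_
  exact Real.logb_nonpos one_lt_two (hp.1 i) (le_one_of_dist hp i)

theorem entropy_le {I : Type*} [Fintype I] (hd : 2 ≤ Fintype.card I) {p : I → ℝ} (hp : IsProbDist p) :
    shannonEntropy p ≤ Real.logb 2 (Fintype.card I) := by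
  have h2 : 0 < Real.log 2 := Real.log_pos one_lt_two
  have hd' : (2:ℝ) ≤ Fintype.card I := by exact_mod_cast hd
  rw [Real.logb, le_div_iff₀ h2, mul_comm, entropy_ln]
  have key : ∀ i, -(p i * Real.log (p i)) ≤
      p i * Real.log (Fintype.card I) + (1 / (Fintype.card I : ℝ) - p i) := by
    intro i
    rcases (hp.1 i).eq_or_lt with h | h
    · rw [← h]; simp
    · have := Real.log_le_sub_one_of_pos (x := 1 / ((Fintype.card I : ℝ) * p i)) (by positivity)
      rw [Real.log_div one_ne_zero (by positivity), Real.log_mul (by positivity) h.ne', Real.log_one] at this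
      have h3 := mul_le_mul_of_nonneg_left this h.le
      have h4 : p i * (1 / ((Fintype.card I : ℝ) * p i) - 1) = 1 / (Fintype.card I : ℝ) - p i := by
        field_simp
      rw [h4] at h3
      linarith
  have := Finset.sum_le_sum (fun i (_ : i ∈ Finset.univ) => key i)
  rw [Finset.sum_add_distrib, Finset.sum_sub_distrib, ← Finset.sum_mul, hp.2, Finset.sum_neg_distrib] at this
  simp only [Finset.sum_const, Finset.card_univ, nsmul_eq_mul] at this
  have h5 : (Fintype.card I : ℝ) * (1 / (Fintype.card I : ℝ)) = 1 := by field_simp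
  linarith

theorem single_letter {I : Type*} [Fintype I] (hd : 2 ≤ Fintype.card I) {p : I → ℝ} (hp : IsProbDist p)
    {h s : ℝ} (hh : h ≤ shannonEntropy p) (hs : 0 < s) :
    ∑ i, p i ^ (1 + s) ≤
      (2:ℝ) ^ (-(s * (h - s * (16 * (Real.logb 2 (Fintype.card I)) ^ 2)))) := by
  have h2 : 0 < Real.log 2 := Real.log_pos one_lt_two
  have hd' : (2:ℝ) ≤ Fintype.card I := by exact_mod_cast hd
  set L := Real.log (Fintype.card I) with hL
  have hL2 : Real.log 2 ≤ L := Real.log_le_log two_pos hd'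
  have hdpos : (0:ℝ) < Fintype.card I := by linarith
  have key : ∀ i, p i ^ (1 + s) ≤ p i + s * (p i * Real.log (p i))
      + s ^ 2 / 2 * (4 * p i * L ^ 2 + 16 / (Fintype.card I : ℝ)) := fun i =>
    (term_rpow (hp.1 i) (le_one_of_dist hp i) hs).trans (by
      have := term_log_sq hd' (hp.1 i) (le_one_of_dist hp i)
      gcongr)
  have hsum := Finset.sum_le_sum (fun i (_ : i ∈ Finset.univ) => key i)
  rw [Finset.sum_add_distrib, Finset.sum_add_distrib, ← Finset.mul_sum, ← Finset.mul_sum,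
    Finset.sum_add_distrib, ← Finset.sum_mul, ← Finset.mul_sum, hp.2] at hsum
  simp only [Finset.sum_const, Finset.card_univ, nsmul_eq_mul] at hsum
  have h5 : (Fintype.card I : ℝ) * (16 / (Fintype.card I : ℝ)) = 16 := by field_simp
  have he := entropy_ln p
  rw [h5] at hsum
  refine hsum.trans ?_
  rw [Real.rpow_def_of_pos two_pos]
  refine le_trans ?_ (Real.add_one_le_exp _)
  have h6 : ∑ i, p i * Real.log (p i) = - (Real.log 2 * shannonEntropy p) := by linarith
  rw [h6, Real.logb, ← hL]
  have h7 : Real.log 2 * -(s * (h - s * (16 * (L / Real.log 2) ^ 2)))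
     = - (s * (Real.log 2 * h)) + s ^ 2 * (16 * L ^ 2 / Real.log 2) := by field_simp; ring
  rw [h7]
  have h8 : s * (Real.log 2 * h) ≤ s * (Real.log 2 * shannonEntropy p) := by gcongr
  have h9 : 2 * L ^ 2 + 8 ≤ 16 * L ^ 2 / Real.log 2 := by
    rw [le_div_iff₀ h2]
    have a1 := Real.log_two_lt_d9
    have a2 := Real.log_two_gt_d9
    have a3 : (0.48:ℝ) ≤ L ^ 2 := by nlinarith
    nlinarith
  have h10 := mul_le_mul_of_nonneg_left h9 (sq_nonneg s)
  nlinarith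

/-- flattening a distribution at level t -/
theorem flatten {J : Type*} [Fintype J] [Nonempty J] {p : J → ℝ} (hp : IsProbDist p) {ε t : ℝ}
    (ht : 0 < t) (htN : 1 ≤ t * Fintype.card J)
    (hbad : ∑ j, (if t < p j then p j else 0) ≤ ε) :
    - Real.logb 2 t ≤ smoothHminDist ε p := by
  set m : J → ℝ := fun j => min (p j) t
  set e : ℝ := ∑ j, (p j - m j) with he
  set g : ℝ := ∑ j, (t - m j) with hg
  have hm1 : ∀ j, m j ≤ p j := fun j => min_le_left _ _
  have hm2 : ∀ j, m j ≤ t := fun j => min_le_right _ _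
  have hm0 : ∀ j, 0 ≤ m j := fun j => le_min (hp.1 j) ht.le
  have he0 : 0 ≤ e := Finset.sum_nonneg fun j _ => sub_nonneg.2 (hm1 j)
  have hg0 : 0 ≤ g := Finset.sum_nonneg fun j _ => sub_nonneg.2 (hm2 j)
  have heg : e ≤ g := by
    rw [he, hg, Finset.sum_sub_distrib, Finset.sum_sub_distrib, hp.2]
    simp only [Finset.sum_const, Finset.card_univ, nsmul_eq_mul]
    linarith
  have heε : e ≤ ε := by
    refine le_trans (Finset.sum_le_sum fun j _ => ?_) hbad
    split_ifs with hc
    · linarith [hm0 j]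
    · simp only [m]; rw [min_eq_left (not_lt.1 hc)]; simp
  set α := e / g with hα
  have hα0 : 0 ≤ α := div_nonneg he0 hg0
  have hα1 : α ≤ 1 := div_le_one_of_le₀ heg hg0
  have hαg : α * g = e := by
    rcases hg0.eq_or_lt with h | h
    · rw [← h]; rw [← h] at heg; linarith
    · rw [hα]; field_simp
  set q : J → ℝ := fun j => m j + α * (t - m j) with hq
  have hqt : ∀ j, q j ≤ t := fun j => by
    have := mul_le_mul_of_nonneg_right hα1 (sub_nonneg.2 (hm2 j)); simp only [hq]; linarith
  have hqd : IsProbDist q := by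
    refine ⟨fun j => add_nonneg (hm0 j) (mul_nonneg hα0 (sub_nonneg.2 (hm2 j))), ?_⟩
    simp only [hq]
    rw [Finset.sum_add_distrib, ← Finset.mul_sum, ← hg, hαg, he, Finset.sum_sub_distrib, hp.2]
    ring
  have hbdd : BddAbove (Set.range q) := (Set.finite_range q).bddAbove
  have hdist : (1/2) * ∑ i, |p i - q i| ≤ ε := by
    have : ∑ i, |p i - q i| ≤ ∑ i, ((p i - m i) + α * (t - m i)) := by
      refine Finset.sum_le_sum fun j _ => ?_
      have := mul_nonneg hα0 (sub_nonneg.2 (hm2 j))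
      have := hm1 j
      simp only [hq]
      rw [abs_le]; constructor <;> linarith
    rw [Finset.sum_add_distrib, ← Finset.mul_sum, ← hg, hαg, ← he] at this
    linarith
  have hsup_pos : ∀ q' : J → ℝ, IsProbDist q' → 1 / (Fintype.card J : ℝ) ≤ ⨆ i, q' i := by
    intro q' hq'
    have hN : (0:ℝ) < Fintype.card J := by exact_mod_cast Fintype.card_pos
    rw [div_le_iff₀ hN, ← hq'.2, mul_comm, ← nsmul_eq_mul, ← Finset.card_univ]
    exact Finset.sum_le_card_nsmul _ _ _ fun j _ => le_ciSup (Set.finite_range q').bddAbove j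
  have hN : (0:ℝ) < Fintype.card J := by exact_mod_cast Fintype.card_pos
  have hle : - Real.logb 2 t ≤ distHmin q := by
    rw [distHmin, neg_le_neg_iff]
    exact Real.logb_le_logb_of_le one_lt_two (lt_of_lt_of_le (by positivity) (hsup_pos q hqd)) (ciSup_le hqt)
  refine hle.trans (le_csSup ⟨- Real.logb 2 (1 / (Fintype.card J : ℝ)), ?_⟩ ⟨q, hqd, hdist, rfl⟩)
  rintro _ ⟨q', hq', -, rfl⟩
  rw [distHmin, neg_le_neg_iff]
  exact Real.logb_le_logb_of_le one_lt_two (by positivity) (hsup_pos q' hq')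

theorem sum_trace_povm {D : ℕ} {I : Type*} [Fintype I] {M : I → Matrix (Fin D) (Fin D) ℂ}
    (hM : IsPOVM M) (ρ : Matrix (Fin D) (Fin D) ℂ) :
    ∑ i, (ρ * M i).trace.re = ρ.trace.re := by
  rw [← Complex.re_sum, ← Matrix.trace_sum, ← Finset.mul_sum, hM.2, mul_one]

theorem density_dist {D : ℕ} {I : Type*} [Fintype I] {M : I → Matrix (Fin D) (Fin D) ℂ}
    (hM : IsPOVM M) {ρ : Matrix (Fin D) (Fin D) ℂ} (hρ : IsDensityMatrix ρ) :
    IsProbDist (fun i => (ρ * M i).trace.re) :=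
  ⟨fun i => trace_mul_psd_nonneg hρ.1 (hM.1 i), by rw [sum_trace_povm hM, hρ.2]; simp⟩

theorem minOut_le {D : ℕ} {I : Type*} [Fintype I] {M : I → Matrix (Fin D) (Fin D) ℂ}
    (hM : IsPOVM M) {ρ : Matrix (Fin D) (Fin D) ℂ} (hρ : IsDensityMatrix ρ) :
    minOutEntropy M ≤ shannonEntropy (fun i => (ρ * M i).trace.re) := by
  refine csInf_le ⟨0, ?_⟩ ⟨ρ, hρ, rfl⟩
  rintro _ ⟨σ, hσ, rfl⟩
  exact entropy_nonneg (density_dist hM hσ)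

theorem single_state {D : ℕ} {I : Type*} [Fintype I] {M : I → Matrix (Fin D) (Fin D) ℂ}
    (hM : IsPOVM M) (hd : 2 ≤ Fintype.card I) {s : ℝ} (hs : 0 < s)
    {ρ : Matrix (Fin D) (Fin D) ℂ} (hρ : ρ.PosSemidef) :
    ∑ i, (ρ * M i).trace.re ^ (1 + s) ≤
      (2:ℝ) ^ (-(s * (minOutEntropy M - s * (16 * (Real.logb 2 (Fintype.card I)) ^ 2))))
        * ρ.trace.re ^ (1 + s) := by
  have htr := Complex.le_def.1 hρ.trace_nonneg
  have hre : 0 ≤ ρ.trace.re := htr.1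
  have him : ρ.trace = (ρ.trace.re : ℂ) := Complex.ext rfl (by simpa using htr.2.symm)
  rcases hre.eq_or_lt with h0 | hpos
  · have : ρ = 0 := by
      rw [← hρ.trace_eq_zero_iff, him, ← h0]; simp
    subst this
    simp [Real.zero_rpow (show 1 + s ≠ 0 by linarith)]
  set τ := ρ.trace.re with hτ
  have hσ : IsDensityMatrix ((((τ⁻¹ : ℝ)) : ℂ) • ρ) := by
    refine ⟨hρ.smul (by simpa using hre), ?_⟩
    rw [Matrix.trace_smul, him, smul_eq_mul]
    have : (τ:ℂ) ≠ 0 := by exact_mod_cast hpos.ne'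
    push_cast
    field_simp
  have h := single_letter hd (density_dist hM hσ) (minOut_le hM hσ) hs
  have e : ∀ i, (((((τ⁻¹ : ℝ)) : ℂ) • ρ) * M i).trace.re = τ⁻¹ * (ρ * M i).trace.re := by
    intro i
    rw [Matrix.smul_mul, Matrix.trace_smul, smul_eq_mul, Complex.re_ofReal_mul]
  simp only [e] at h
  have e2 : ∀ i, (ρ * M i).trace.re ^ (1 + s) = (τ⁻¹ * (ρ * M i).trace.re) ^ (1 + s) * τ ^ (1 + s) := by
    intro i
    have h0 := trace_mul_psd_nonneg hρ (hM.1 i)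
    rw [← Real.mul_rpow (by positivity) hre]
    congr 1
    field_simp
  rw [Finset.sum_congr rfl fun i _ => e2 i, ← Finset.sum_mul]
  exact mul_le_mul_of_nonneg_right h (by positivity)

theorem tensor_moment {D : ℕ} {I : Type*} [Fintype I] {M : I → Matrix (Fin D) (Fin D) ℂ}
    (hM : IsPOVM M) {s K : ℝ} (hK : 0 ≤ K)
    (hstep : ∀ ρ : Matrix (Fin D) (Fin D) ℂ, ρ.PosSemidef →
      ∑ i, (ρ * M i).trace.re ^ (1 + s) ≤ K * ρ.trace.re ^ (1 + s)) (n : ℕ) :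
    ∀ ψ : Matrix (Fin n → Fin D) (Fin n → Fin D) ℂ, ψ.PosSemidef →
      (∀ iv, 0 ≤ (ψ * tensorPowFam M n iv).trace.re) ∧
      (∑ iv, (ψ * tensorPowFam M n iv).trace.re = ψ.trace.re) ∧
      (∑ iv, (ψ * tensorPowFam M n iv).trace.re ^ (1 + s) ≤ K ^ n * ψ.trace.re ^ (1 + s)) := by
  induction n with
  | zero =>
    intro ψ hψ
    have e : ∀ iv, (ψ * tensorPowFam M 0 iv).trace = ψ.trace := by
      intro iv
      simp [Matrix.trace, Matrix.mul_apply, tensorPowFam]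
    simp only [e]
    refine ⟨fun _ => (Complex.le_def.1 hψ.trace_nonneg).1, by simp, by simp⟩
  | succ n ih =>
    intro ψ hψ
    have ihi := fun i => ih (redState ψ (M i)) (redState_psd hψ (hM.1 i))
    refine ⟨?_, ?_, ?_⟩
    · intro iv
      rw [← Fin.cons_self_tail iv, trace_tensor_cons]
      exact (ihi _).1 _
    · rw [sum_cons_eq]
      simp only [trace_tensor_cons, (ihi _).2.1, trace_redState]
      rw [sum_trace_povm hM, trace_margState]
    · rw [sum_cons_eq]
      simp only [trace_tensor_cons]
      refine (Finset.sum_le_sum fun i _ => (ihi i).2.2).trans ?_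
      simp only [trace_redState]
      rw [← Finset.mul_sum, pow_succ, mul_assoc, ← trace_margState]
      exact mul_le_mul_of_nonneg_left (hstep _ (margState_psd hψ)) (pow_nonneg hK n)

/-- high-order min-entropy uncertainty relation for the output
distribution of a tensor-power POVM. -/
theorem smooth_min_entropy_tensor_povm
    {D : ℕ} {I : Type} [Fintype I] (M : I → Matrix (Fin D) (Fin D) ℂ)
    (hM : IsPOVM M) (hd : 2 ≤ Fintype.card I)
    (n : ℕ) (hn : 1 ≤ n) (ε : ℝ) (hε0 : 0 < ε) (hε1 : ε < 1)
    (δ : ℝ) (hδ0 : 0 < δ) (hδ1 : δ < 1)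
    (ψ : Matrix (Fin n → Fin D) (Fin n → Fin D) ℂ) (hψ : IsDensityMatrix ψ) :
    smoothHminDist ε (fun iv : Fin n → I => ((ψ * tensorPowFam M n iv).trace).re)
    ≥ n * (minOutEntropy M - δ)
      - 16 * (Real.logb 2 (Fintype.card I)) ^ 2 * (1 / δ) * Real.logb 2 (1 / ε) := by
  have hd' : (2:ℝ) ≤ Fintype.card I := by exact_mod_cast hd
  have hdpos : (0:ℝ) < Fintype.card I := by linarith
  have : Nonempty I := Fintype.card_pos_iff.1 (by omega)
  set l := Real.logb 2 (Fintype.card I) with hl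
  have hl1 : 1 ≤ l := by
    rw [hl, Real.le_logb_iff_rpow_le one_lt_two hdpos]; simpa using hd'
  set h := minOutEntropy M with hh
  have hhl : h ≤ l := by
    obtain ⟨m, rfl⟩ : ∃ m, n = m + 1 := ⟨n - 1, by omega⟩
    have hρ : IsDensityMatrix (margState ψ) :=
      ⟨margState_psd hψ.1, by rw [trace_margState, hψ.2]⟩
    exact (minOut_le hM hρ).trans (entropy_le hd (density_dist hM hρ))
  set c := 16 * l ^ 2 with hc
  have hcpos : 0 < c := by positivity
  set s := δ / c with hs
  have hspos : 0 < s := div_pos hδ0 hcpos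
  have hsc : s * c = δ := by rw [hs]; field_simp
  obtain ⟨h1, h2, h3⟩ := tensor_moment hM (s := s) (Real.rpow_nonneg two_pos.le _)
    (fun ρ hρ => single_state hM hd hspos hρ) n ψ hψ.1
  rw [← hh, ← hl, ← hc, hsc, hψ.2, Complex.one_re, Real.one_rpow, mul_one] at h3
  rw [hψ.2, Complex.one_re] at h2
  set lε := Real.logb 2 (1 / ε) with hlε
  have hlε0 : 0 ≤ lε := Real.logb_nonneg one_lt_two (by rw [le_div_iff₀ hε0]; linarith)
  set X := n * (h - δ) - c * (1 / δ) * lε with hX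
  set t : ℝ := (2:ℝ) ^ (-X) with ht
  have htpos : 0 < t := Real.rpow_pos_of_pos two_pos _
  have hgoal := flatten (p := fun iv : Fin n → I => ((ψ * tensorPowFam M n iv).trace).re)
    (ε := ε) (t := t) ⟨h1, h2⟩ htpos ?_ ?_
  · rw [ht, Real.logb_rpow two_pos (by norm_num), neg_neg] at hgoal
    exact hgoal
  · have e : (Fintype.card (Fin n → I) : ℝ) = (2:ℝ) ^ (l * n) := by
      rw [Real.rpow_mul two_pos.le, Real.rpow_logb two_pos (by norm_num) hdpos]
      simp
    rw [e, ht, ← Real.rpow_add two_pos]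
    apply Real.one_le_rpow one_lt_two.le
    have : 0 ≤ c * (1 / δ) * lε := by positivity
    have h5 : (n:ℝ) * h ≤ n * l := by gcongr
    have h6 : 0 ≤ (n:ℝ) * δ := by positivity
    rw [hX]; linarith
  · have key : ∀ iv : Fin n → I, (if t < ((ψ * tensorPowFam M n iv).trace).re then
        ((ψ * tensorPowFam M n iv).trace).re else 0) ≤
        ((ψ * tensorPowFam M n iv).trace).re ^ (1 + s) * t ^ (-s) := by
      intro iv
      split_ifs with hlt
      · have hp := htpos.trans hlt
        rw [Real.rpow_add hp, Real.rpow_one, Real.rpow_neg htpos.le, mul_assoc]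
        refine le_mul_of_one_le_right hp.le ?_
        rw [← div_eq_mul_inv, one_le_div (by positivity)]
        exact Real.rpow_le_rpow htpos.le hlt.le hspos.le
      · exact mul_nonneg (Real.rpow_nonneg (h1 iv) _) (Real.rpow_nonneg htpos.le _)
    refine (Finset.sum_le_sum fun iv _ => key iv).trans ?_
    rw [← Finset.sum_mul]
    refine (mul_le_mul_of_nonneg_right h3 (Real.rpow_nonneg htpos.le _)).trans ?_
    rw [ht, ← Real.rpow_natCast, ← Real.rpow_mul two_pos.le, ← Real.rpow_mul two_pos.le,
      ← Real.rpow_add two_pos]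
    have e1 : -(s * (h - δ)) * n + -X * -s = - lε := by
      have : s * (c * (1 / δ) * lε) = lε := by
        rw [← mul_assoc, ← mul_assoc, hsc]; field_simp
      rw [hX]; linear_combination -this
    rw [e1, hlε, one_div, Real.logb_inv, neg_neg, Real.rpow_logb two_pos (by norm_num) hε0]

end
end

section
/- Fix density matrices (ρ_i)_{i∈I} on a finite-dimensional complex Hilbert space E, where I is a finite set. For a probability distribution p on I and a POVM Q = (Q_j)_{j∈J} on E (with arbitrary finite outcome set J), let H(I|J)_{p,Q} denote the conditional Shannon entropy of the joint distribution P(i,j) = p_i·tr(ρ_i Q_j). Then the minimax equality holds: sup over probability distributions p on I of [inf over POVMs Q on E with arbitrary finite outcome sets of H(I|J)_{p,Q}] = inf over POVMs Q on E with arbitrary finite outcome sets of [sup over probability distributions p on I of H(I|J)_{p,Q}]. -/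
open scoped BigOperators ComplexOrder

noncomputable section

/-- Conditional Shannon entropy `H(A|B)_P = H(P) − H(P_B)` of a joint distribution
on `A × B`, where `P_B` is the marginal on `B`. -/
def condEntropy {A B : Type*} [Fintype A] [Fintype B] (P : A × B → ℝ) : ℝ :=
  shannonEntropy P - shannonEntropy (fun b => ∑ a, P (a, b))

/-- A POVM on the space with index type `n`, with an arbitrary finite outcome set. -/
structure POVM (n : Type) [Fintype n] [DecidableEq n] where
  ι : Type
  [fin : Fintype ι]
  elem : ι → Matrix n n ℂ
  psd : ∀ j, (elem j).PosSemidef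
  sum_eq_one : ∑ j, elem j = 1

attribute [instance] POVM.fin

lemma aux_trace_nonneg {n : Type*} [Fintype n] {A B : Matrix n n ℂ}
    (hA : A.PosSemidef) (hB : B.PosSemidef) : 0 ≤ ((A * B).trace).re := by
  obtain ⟨m, v, rfl⟩ := Matrix.posSemidef_iff_eq_sum_vecMulVec.mp hB
  rw [Finset.mul_sum, Matrix.trace_sum, Complex.re_sum]
  refine Finset.sum_nonneg fun k _ => ?_
  rw [Matrix.mul_vecMulVec, Matrix.trace_vecMulVec, dotProduct_comm]
  exact (Complex.le_def.mp (hA.dotProduct_mulVec_nonneg (v k))).1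

/-- unnormalised conditional entropy of a column, in nats -/
def colEnt {I : Type*} [Fintype I] (v : I → ℝ) : ℝ :=
  ∑ i, Real.negMulLog (v i) - Real.negMulLog (∑ i, v i)

lemma colEnt_smul {I : Type*} [Fintype I] (c : ℝ) (v : I → ℝ) :
    colEnt (fun i => c * v i) = c * colEnt v := by
  unfold colEnt
  simp only [← Finset.mul_sum, Real.negMulLog_mul, Finset.sum_add_distrib, ← Finset.sum_mul]
  ring

lemma colEnt_eq {I : Type*} [Fintype I] (v : I → ℝ) (hs : ∑ i, v i ≠ 0) :
    colEnt v = ∑ i, (∑ k, v k) * Real.negMulLog (v i / ∑ k, v k) := by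
  set s := ∑ i, v i with hsdef
  have h : ∀ i, v i = s * (v i / s) := fun i => by field_simp
  have h2 : ∑ i, v i / s = 1 := by rw [← Finset.sum_div, ← hsdef, div_self hs]
  have h3 : ∑ i, Real.negMulLog (v i) = ∑ i, (v i / s * Real.negMulLog s
      + s * Real.negMulLog (v i / s)) := by
    refine Finset.sum_congr rfl fun i _ => ?_
    conv_lhs => rw [h i]
    rw [Real.negMulLog_mul]
  unfold colEnt
  rw [h3, Finset.sum_add_distrib, ← Finset.sum_mul, h2, ← hsdef]
  ring

lemma colEnt_nonneg {I : Type*} [Fintype I] (v : I → ℝ) (hv : ∀ i, 0 ≤ v i) :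
    0 ≤ colEnt v := by
  by_cases hs : ∑ i, v i = 0
  · have h0 := (Finset.sum_eq_zero_iff_of_nonneg (fun i _ => hv i)).mp hs
    have : v = fun _ => 0 := funext fun i => h0 i (Finset.mem_univ i)
    subst this
    simp [colEnt]
  · rw [colEnt_eq v hs]
    have hs0 : 0 ≤ ∑ i, v i := Finset.sum_nonneg fun i _ => hv i
    refine Finset.sum_nonneg fun i _ => mul_nonneg hs0 (Real.negMulLog_nonneg
      (div_nonneg (hv i) hs0) (div_le_one_of_le₀
        (Finset.single_le_sum (fun i _ => hv i) (Finset.mem_univ i)) hs0))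

lemma negMulLog_persp {a b s t : ℝ} (ha : 0 ≤ a) (hb : 0 ≤ b) (hs : 0 < s) (ht : 0 < t) :
    s * Real.negMulLog (a / s) + t * Real.negMulLog (b / t)
      ≤ (s + t) * Real.negMulLog ((a + b) / (s + t)) := by
  have h := Real.concaveOn_negMulLog.2
    (Set.mem_Ici.mpr (by positivity : 0 ≤ a / s)) (Set.mem_Ici.mpr (by positivity : 0 ≤ b / t))
    (by positivity : 0 ≤ s / (s + t)) (by positivity : 0 ≤ t / (s + t)) (by field_simp)
  simp only [smul_eq_mul] at h
  have e : s / (s + t) * (a / s) + t / (s + t) * (b / t) = (a + b) / (s + t) := by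
    field_simp
  rw [e] at h
  have h' := mul_le_mul_of_nonneg_left h (by positivity : 0 ≤ s + t)
  refine le_trans (le_of_eq ?_) h'
  field_simp

lemma colEnt_superadd {I : Type*} [Fintype I] (v w : I → ℝ) (hv : ∀ i, 0 ≤ v i)
    (hw : ∀ i, 0 ≤ w i) : colEnt v + colEnt w ≤ colEnt (fun i => v i + w i) := by
  have key : ∀ u : I → ℝ, (∀ i, 0 ≤ u i) → ∑ i, u i = 0 → u = fun _ => 0 := by
    intro u hu hs
    have h0 := (Finset.sum_eq_zero_iff_of_nonneg (fun i _ => hu i)).mp hs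
    exact funext fun i => h0 i (Finset.mem_univ i)
  have z : colEnt (fun _ : I => (0 : ℝ)) = 0 := by simp [colEnt]
  by_cases hs : ∑ i, v i = 0
  · have := key v hv hs
    subst this
    simp [z]
  by_cases ht : ∑ i, w i = 0
  · have := key w hw ht
    subst this
    simp [z]
  have hs0 : 0 < ∑ i, v i := lt_of_le_of_ne (Finset.sum_nonneg fun i _ => hv i) (Ne.symm hs)
  have ht0 : 0 < ∑ i, w i := lt_of_le_of_ne (Finset.sum_nonneg fun i _ => hw i) (Ne.symm ht)
  have e : ∑ i, (v i + w i) = ∑ i, v i + ∑ i, w i := Finset.sum_add_distrib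
  rw [colEnt_eq v hs, colEnt_eq w ht, colEnt_eq _ (by rw [e]; positivity), e,
    ← Finset.sum_add_distrib]
  exact Finset.sum_le_sum fun i _ => negMulLog_persp (hv i) (hw i) hs0 ht0

lemma condEntropy_eq {A B : Type*} [Fintype A] [Fintype B] (P : A × B → ℝ) :
    condEntropy P = (∑ b, colEnt (fun a => P (a, b))) / Real.log 2 := by
  have h : ∀ x : ℝ, x * Real.logb 2 x = - (Real.negMulLog x / Real.log 2) := fun x => by
    simp only [Real.logb, Real.negMulLog]; ring
  unfold condEntropy shannonEntropy colEnt
  simp only [h, Finset.sum_neg_distrib, neg_neg, ← Finset.sum_div, Finset.sum_sub_distrib]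
  rw [Fintype.sum_prod_type_right, sub_div]

/-- a convex-like minimax theorem -/
lemma minimax_convexlike {E : Type} [TopologicalSpace E] [T2Space E] [AddCommGroup E] [Module ℝ E]
    [IsTopologicalAddGroup E] [ContinuousSMul ℝ E] {K : Type*} [Nonempty K]
    (X : Set E) (hX : X.Nonempty) (kX : IsCompact X) (cX : Convex ℝ X)
    (F : E → K → ℝ) (hpos : ∀ p ∈ X, ∀ Q, 0 ≤ F p Q)
    (hcont : ∀ Q, Continuous fun p => F p Q)
    (hconc : ∀ Q, ConcaveOn ℝ X fun p => F p Q)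
    (hmix : ∀ (m : ℕ) (w : Fin m → ℝ) (Q : Fin m → K), w ∈ stdSimplex ℝ (Fin m) →
      ∃ R, ∀ p, F p R = ∑ k, w k * F p (Q k)) :
    sSup {v : ℝ | ∃ p, p ∈ X ∧ v = sInf {h : ℝ | ∃ Q, h = F p Q}}
      = sInf {v : ℝ | ∃ Q, v = sSup {h : ℝ | ∃ p, p ∈ X ∧ h = F p Q}} := by
  have bA : ∀ Q, BddAbove {h : ℝ | ∃ p, p ∈ X ∧ h = F p Q} := by
    intro Q
    refine (kX.bddAbove_image (hcont Q).continuousOn).mono ?_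
    rintro _ ⟨p, hp, rfl⟩
    exact ⟨p, hp, rfl⟩
  have bB : ∀ p ∈ X, BddBelow {h : ℝ | ∃ Q, h = F p Q} := by
    intro p hp
    refine ⟨0, ?_⟩
    rintro _ ⟨Q, rfl⟩
    exact hpos p hp Q
  obtain ⟨p₀, hp₀⟩ := hX
  obtain ⟨Q₀⟩ := ‹Nonempty K›
  have bBB : BddBelow {v : ℝ | ∃ Q, v = sSup {h : ℝ | ∃ p, p ∈ X ∧ h = F p Q}} := by
    refine ⟨0, ?_⟩
    rintro _ ⟨Q, rfl⟩
    exact le_csSup_of_le (bA Q) ⟨p₀, hp₀, rfl⟩ (hpos p₀ hp₀ Q)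
  have bAA : BddAbove {v : ℝ | ∃ p, p ∈ X ∧ v = sInf {h : ℝ | ∃ Q, h = F p Q}} := by
    obtain ⟨M, hM⟩ := bA Q₀
    refine ⟨M, ?_⟩
    rintro _ ⟨p, hp, rfl⟩
    exact csInf_le_of_le (bB p hp) ⟨Q₀, rfl⟩ (hM ⟨p, hp, rfl⟩)
  apply le_antisymm
  · refine csSup_le ⟨_, p₀, hp₀, rfl⟩ ?_
    rintro _ ⟨p, hp, rfl⟩
    refine le_csInf ⟨_, Q₀, rfl⟩ ?_
    rintro _ ⟨Q, rfl⟩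
    exact (csInf_le (bB p hp) ⟨Q, rfl⟩).trans (le_csSup (bA Q) ⟨p, hp, rfl⟩)
  set c := sInf {v : ℝ | ∃ Q, v = sSup {h : ℝ | ∃ p, p ∈ X ∧ h = F p Q}} with hc
  suffices h : ∃ p ∈ X, ∀ Q, c ≤ F p Q by
    obtain ⟨p, hp, h⟩ := h
    refine le_csSup_of_le bAA ⟨p, hp, rfl⟩ (le_csInf ⟨_, Q₀, rfl⟩ ?_)
    rintro _ ⟨Q, rfl⟩
    exact h Q
  have fin : ∀ u : Finset K, (X ∩ ⋂ Q ∈ u, {p | c ≤ F p Q}).Nonempty := by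
    intro u
    rcases u.eq_empty_or_nonempty with rfl | hu
    · exact ⟨p₀, by simpa using hp₀⟩
    let q : Fin u.card → K := fun k => (u.equivFin.symm k : K)
    have hm : 0 < u.card := hu.card_pos
    obtain ⟨a, ha, b, hb, hab⟩ := Sion.exists_isSaddlePointOn' (X := X)
      (Y := stdSimplex ℝ (Fin u.card)) (f := fun p w => - ∑ k, w k * F p (q k))
      ⟨p₀, hp₀⟩ kX
      (fun w _ => (Continuous.continuousOn (by
        have := fun k => hcont (q k)
        fun_prop)).lowerSemicontinuousOn)
      (fun w hw => by
        refine ConvexOn.quasiconvexOn (ConcaveOn.neg (f := fun p => ∑ k, w k * F p (q k)) ?_)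
        refine ⟨cX, fun x hx y hy s t hs ht hst => ?_⟩
        simp only [smul_eq_mul, Finset.mul_sum, ← Finset.sum_add_distrib]
        refine Finset.sum_le_sum fun k _ => ?_
        have := mul_le_mul_of_nonneg_left ((hconc (q k)).2 hx hy hs ht hst) (hw.1 k)
        simp only [smul_eq_mul] at this
        linarith)
      (convex_stdSimplex ℝ _) (isCompact_stdSimplex ℝ _)
      (fun p _ => (Continuous.continuousOn (by fun_prop)).upperSemicontinuousOn)
      (fun p _ => by
        refine ConcaveOn.quasiconcaveOn ⟨convex_stdSimplex ℝ _, fun x hx y hy s t hs ht hst => ?_⟩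
        apply le_of_eq
        simp only [smul_eq_mul, Pi.add_apply, Pi.smul_apply, add_mul, Finset.sum_add_distrib,
          mul_assoc, ← Finset.mul_sum]
        ring)
      cX ⟨_, single_mem_stdSimplex ℝ (⟨0, hm⟩ : Fin u.card)⟩
    obtain ⟨R, hR⟩ := hmix _ b q hb
    have hcR : c ≤ sSup {h : ℝ | ∃ p, p ∈ X ∧ h = F p R} := csInf_le bBB ⟨R, rfl⟩
    refine ⟨a, ha, ?_⟩
    simp only [Set.mem_iInter, Set.mem_ofPred_eq]
    intro Q hQ
    refine hcR.trans (csSup_le ⟨_, p₀, hp₀, rfl⟩ ?_)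
    rintro _ ⟨p, hp, rfl⟩
    have h := hab p hp _ (single_mem_stdSimplex ℝ (u.equivFin ⟨Q, hQ⟩))
    rw [hR]
    have hq : q (u.equivFin ⟨Q, hQ⟩) = Q := by simp [q]
    simp only [neg_le_neg_iff] at h
    simpa [Pi.single_apply, hq] using h
  obtain ⟨p, hp, hp'⟩ := kX.inter_iInter_nonempty (fun Q => {p | c ≤ F p Q})
    (fun Q => isClosed_le continuous_const (hcont Q)) fin
  exact ⟨p, hp, fun Q => Set.mem_iInter.mp hp' Q⟩

/-- randomised choice among finitely many POVMs -/
def mixPOVM {n : Type} [Fintype n] [DecidableEq n] {m : ℕ} (w : Fin m → ℝ)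
    (Q : Fin m → POVM n) (hw : w ∈ stdSimplex ℝ (Fin m)) : POVM n where
  ι := Σ k, (Q k).ι
  elem := fun x => (w x.1 : ℂ) • (Q x.1).elem x.2
  psd := fun x => ((Q x.1).psd x.2).smul (by exact_mod_cast hw.1 x.1)
  sum_eq_one := by
    rw [Fintype.sum_sigma]
    simp only [← Finset.smul_sum, (Q _).sum_eq_one, ← Finset.sum_smul]
    rw [← Complex.ofReal_sum, hw.2]
    simp

/-- minimax equality for the conditional Shannon entropy `H(I|J)` of the
joint distribution `P(i,j) = p_i·tr(ρ_i Q_j)`: the sup over priors of the inf over POVMs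
(with arbitrary finite outcome sets) equals the inf over POVMs of the sup over priors. -/
theorem cond_entropy_minimax
    {D : ℕ} {I : Type} [Fintype I]
    (ρ : I → Matrix (Fin D) (Fin D) ℂ) (hρ : ∀ i, IsDensityMatrix (ρ i)) :
    sSup { v : ℝ | ∃ p : I → ℝ, IsProbDist p ∧
        v = sInf { h : ℝ | ∃ Q : POVM (Fin D),
          h = condEntropy (fun x : I × Q.ι => p x.1 * ((ρ x.1 * Q.elem x.2).trace).re) } }
    = sInf { v : ℝ | ∃ Q : POVM (Fin D),
        v = sSup { h : ℝ | ∃ p : I → ℝ, IsProbDist p ∧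
          h = condEntropy (fun x : I × Q.ι => p x.1 * ((ρ x.1 * Q.elem x.2).trace).re) } } := by
  classical
  rcases isEmpty_or_nonempty I with hI | hI
  · have h : ∀ p : I → ℝ, ¬ IsProbDist p := fun p hp => by
      have := hp.2
      simp at this
    have Q₀ : POVM (Fin D) := ⟨Unit, fun _ => 1, fun _ => Matrix.PosSemidef.one, by simp⟩
    have e : {v : ℝ | Nonempty (POVM (Fin D)) ∧ v = 0} = {0} := by
      ext v
      exact ⟨fun ⟨_, hv⟩ => hv, fun hv => ⟨⟨Q₀⟩, hv⟩⟩
    simp [h, e]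
  have Q₀ : Nonempty (POVM (Fin D)) :=
    ⟨⟨Unit, fun _ => 1, fun _ => Matrix.PosSemidef.one, by simp⟩⟩
  have hlog : 0 < Real.log 2 := Real.log_pos (by norm_num)
  have ht : ∀ (Q : POVM (Fin D)) i j, 0 ≤ ((ρ i * Q.elem j).trace).re :=
    fun Q i j => aux_trace_nonneg (hρ i).1 (Q.psd j)
  refine minimax_convexlike (stdSimplex ℝ I) ⟨_, single_mem_stdSimplex ℝ hI.some⟩
    (isCompact_stdSimplex ℝ I) (convex_stdSimplex ℝ I)
    (fun p (Q : POVM (Fin D)) =>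
      condEntropy (fun x : I × Q.ι => p x.1 * ((ρ x.1 * Q.elem x.2).trace).re)) ?_ ?_ ?_ ?_
  · intro p hp Q
    rw [condEntropy_eq]
    exact div_nonneg (Finset.sum_nonneg fun j _ => colEnt_nonneg _
      fun i => mul_nonneg (hp.1 i) (ht Q i j)) hlog.le
  · intro Q
    simp only [condEntropy_eq, colEnt]
    fun_prop
  · intro Q
    refine ⟨convex_stdSimplex ℝ I, fun x hx y hy s t hs ht' hst => ?_⟩
    simp only [condEntropy_eq, smul_eq_mul, ← mul_div_assoc, ← add_div]
    refine div_le_div_of_nonneg_right ?_ hlog.le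
    rw [Finset.mul_sum, Finset.mul_sum, ← Finset.sum_add_distrib]
    refine Finset.sum_le_sum fun j _ => ?_
    rw [← colEnt_smul, ← colEnt_smul]
    refine (colEnt_superadd _ _
      (fun i => mul_nonneg hs (mul_nonneg (hx.1 i) (ht Q i j)))
      (fun i => mul_nonneg ht' (mul_nonneg (hy.1 i) (ht Q i j)))).trans (le_of_eq ?_)
    congr 1
    funext i
    simp only [Pi.add_apply, Pi.smul_apply, smul_eq_mul]
    ring
  · intro m w Q hw
    refine ⟨mixPOVM w Q hw, fun p => ?_⟩
    simp only [condEntropy_eq, ← mul_div_assoc, ← Finset.sum_div]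
    congr 1
    refine (Fintype.sum_sigma (α := fun k => (Q k).ι) _).trans ?_
    refine Finset.sum_congr rfl fun k _ => ?_
    rw [Finset.mul_sum]
    refine Finset.sum_congr rfl fun j _ => ?_
    rw [← colEnt_smul]
    congr 1
    funext i
    simp only [mixPOVM, Matrix.mul_smul, Matrix.trace_smul, smul_eq_mul, Complex.re_ofReal_mul]
    ring

end
end
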